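/- For n ≥ 3 and every vertex v of P_2 □ C_n, the domination value DV(v) equals: 1 if n ≡ 0 (mod 4); (n+1)/2 if n ≡ 1 or 3 (mod 4) and n ≠ 3; (⌈(n+1)/2⌉)² if n ≡ 2 (mod 4) and n ≠ 6; 3 if n = 3; and 17 if n = 6. -/

import Mathlib

open SimpleGraph Finset
open scoped Classical

/-- `D` is a dominating set of `G`: every vertex not in `D` is adjacent to a vertex in `D`. -/
def isDomSet {V : Type*} (G : SimpleGraph V) (D : Finset V) : Prop :=
  ∀ v : V, v ∉ D → ∃ u ∈ D, G.Adj u v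

/-- The domination number `γ(G)`: minimum cardinality of a dominating set of `G`. -/
noncomputable def domNum {V : Type*} [Fintype V] (G : SimpleGraph V) : ℕ :=
  sInf {n | ∃ D : Finset V, isDomSet G D ∧ D.card = n}

/-- The collection of minimum dominating sets (`γ(G)`-sets) of `G`. -/
noncomputable def gammaSets {V : Type*} [Fintype V] (G : SimpleGraph V) : Finset (Finset V) :=
  Finset.univ.filter (fun D => isDomSet G D ∧ D.card = domNum G)

/-- `τ(G)`: the total number of `γ(G)`-sets. -/
noncomputable def tau {V : Type*} [Fintype V] (G : SimpleGraph V) : ℕ :=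
  (gammaSets G).card

/-- The domination value `DV_G(v)`: the number of `γ(G)`-sets containing `v`. -/
noncomputable def DV {V : Type*} [Fintype V] (G : SimpleGraph V) (v : V) : ℕ :=
  ((gammaSets G).filter (fun D => v ∈ D)).card

/-- A column of `P₂ □ Cₙ`, recording which of its two vertices are selected. -/
abbrev Col := Bool × Bool

/-- The number of selected vertices in a column. -/
def Col.weight (c : Col) : ℕ := c.1.toNat + c.2.toNat

/-- The vertices that a column `c` preceded by `b` needs to find in the column after it. -/
def demand (b c : Col) : Col := if c = ⊥ then bᶜ else ⊥

/-- Reading the columns of `f` after a column `b` whose successor must contain `r`, and then the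
column `t`, every column of `f` is dominated. -/
def Accepts (t : Col) : (m : ℕ) → Col → Col → (Fin m → Col) → Prop
  | 0, _, r, _ => r ≤ t
  | m + 1, b, r, f => r ≤ f 0 ∧ Accepts t m (f 0) (demand b (f 0)) (Fin.tail f)

/-- A potential on the states `(b, r)` making the reduced cost of every transition nonnegative. -/
def potential (b r : Col) : ℕ := if b ≠ ⊥ then 3 else if r = ⊤ then 0 else 2

/-- The least potential of a state that accepts the final column `t`. -/
def offset (t : Col) : ℕ := if t = ⊤ then 0 else 2

/-- The number of accepted words of length `m` from the state `(b, r)` with excess `e`. -/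
noncomputable def wordCount (t : Col) (m : ℕ) (b r : Col) (e : ℕ) : ℕ :=
  #{f : Fin m → Col | Accepts t m b r f ∧
    2 * ∑ i, (f i).weight + potential b r = m + e + offset t}

lemma potential_step : ∀ b r c : Col, r ≤ c →
    1 + potential c (demand b c) ≤ 2 * c.weight + potential b r := by
  decide

lemma offset_le_potential : ∀ t b r : Col, t ≠ ⊥ → r ≤ t → offset t ≤ potential b r := by
  decide

/-- Accepted words have nonnegative excess. -/
lemma Accepts.le_weight {t : Col} (ht : t ≠ ⊥) {m : ℕ} {b r : Col} {f : Fin m → Col}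
    (h : Accepts t m b r f) :
    m + offset t ≤ 2 * ∑ i, (f i).weight + potential b r := by
  induction m generalizing b r with
  | zero => simpa using offset_le_potential t b r ht h
  | succ m ih =>
    have h1 := ih h.2
    have h2 := potential_step b r (f 0) h.1
    rw [Fin.sum_univ_succ]
    simp only [Fin.tail] at h1
    omega

lemma card_filter_cons {α : Type*} [Fintype α] {m : ℕ} (P : (Fin (m + 1) → α) → Prop)
    [DecidablePred P] :
    #{f | P f} = ∑ c, #{f : Fin m → α | P (Fin.cons c f)} := by
  simp only [card_filter]
  rw [← Fintype.sum_prod_type' (f := fun c f => if P (Fin.cons c f) then 1 else 0)]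
  exact (Fintype.sum_equiv (Fin.consEquiv fun _ : Fin (m + 1) => α) _ _ fun _ => rfl).symm

lemma wordCount_zero (t b r : Col) (e : ℕ) :
    wordCount t 0 b r e = if r ≤ t ∧ potential b r = e + offset t then 1 else 0 := by
  split_ifs with h <;> simp [wordCount, Accepts, h]

lemma wordCount_succ {t : Col} (ht : t ≠ ⊥) (m : ℕ) (b r : Col) (e : ℕ) :
    wordCount t (m + 1) b r e = ∑ c : Col,
      if r ≤ c ∧ 2 * c.weight + potential b r ≤ 1 + e + potential c (demand b c) then
        wordCount t m c (demand b c)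
          (1 + e + potential c (demand b c) - (2 * c.weight + potential b r))
      else 0 := by
  rw [wordCount, card_filter_cons]
  refine sum_congr rfl fun c _ => ?_
  simp only [Accepts, Fin.cons_zero, Fin.tail_cons, Fin.sum_univ_succ, Fin.cons_succ]
  split_ifs with h
  · refine congrArg card (filter_congr fun f _ => ?_)
    simp only [h.1, true_and]
    refine and_congr_right fun _ => ?_
    omega
  · refine card_eq_zero.2 (filter_eq_empty_iff.2 ?_)
    rintro f - ⟨⟨hr, hf⟩, hw⟩
    have := hf.le_weight ht
    exact h ⟨hr, by omega⟩


set_option maxHeartbeats 1000000 in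
/-- The recurrences between the counts for the reachable states and excess at most two. -/
lemma wordCount_recurrences {t : Col} (ht : t ≠ ⊥) (m : ℕ) :
    wordCount t (m + 1) (true, true) (false, false) 0 =
      wordCount t m (false, false) (false, false) 0 ∧
    wordCount t (m + 1) (true, true) (false, false) 1 =
      wordCount t m (true, false) (false, false) 0 +
      wordCount t m (false, true) (false, false) 0 +
      wordCount t m (false, false) (false, false) 1 ∧
    wordCount t (m + 1) (true, true) (false, false) 2 =
      wordCount t m (true, false) (false, false) 1 +
      wordCount t m (false, true) (false, false) 1 +
      wordCount t m (false, false) (false, false) 2 ∧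
    wordCount t (m + 1) (true, false) (false, false) 0 =
      wordCount t m (false, false) (false, true) 0 ∧
    wordCount t (m + 1) (true, false) (false, false) 1 =
      wordCount t m (true, false) (false, false) 0 +
      wordCount t m (false, true) (false, false) 0 +
      wordCount t m (false, false) (false, true) 1 ∧
    wordCount t (m + 1) (true, false) (false, false) 2 =
      wordCount t m (true, false) (false, false) 1 +
      wordCount t m (false, true) (false, false) 1 +
      wordCount t m (false, false) (false, true) 2 ∧
    wordCount t (m + 1) (false, true) (false, false) 0 =
      wordCount t m (false, false) (true, false) 0 ∧
    wordCount t (m + 1) (false, true) (false, false) 1 =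
      wordCount t m (true, false) (false, false) 0 +
      wordCount t m (false, true) (false, false) 0 +
      wordCount t m (false, false) (true, false) 1 ∧
    wordCount t (m + 1) (false, true) (false, false) 2 =
      wordCount t m (true, false) (false, false) 1 +
      wordCount t m (false, true) (false, false) 1 +
      wordCount t m (false, false) (true, false) 2 ∧
    wordCount t (m + 1) (false, false) (false, false) 0 =
      wordCount t m (true, false) (false, false) 0 +
      wordCount t m (false, true) (false, false) 0 ∧
    wordCount t (m + 1) (false, false) (false, false) 1 =
      wordCount t m (true, false) (false, false) 1 +
      wordCount t m (false, true) (false, false) 1 +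
      wordCount t m (false, false) (true, true) 0 ∧
    wordCount t (m + 1) (false, false) (false, false) 2 =
      wordCount t m (true, true) (false, false) 0 +
      wordCount t m (true, false) (false, false) 2 +
      wordCount t m (false, true) (false, false) 2 +
      wordCount t m (false, false) (true, true) 1 ∧
    wordCount t (m + 1) (false, false) (true, false) 0 =
      wordCount t m (true, false) (false, false) 0 ∧
    wordCount t (m + 1) (false, false) (true, false) 1 =
      wordCount t m (true, false) (false, false) 1 ∧
    wordCount t (m + 1) (false, false) (true, false) 2 =
      wordCount t m (true, true) (false, false) 0 +
      wordCount t m (true, false) (false, false) 2 ∧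
    wordCount t (m + 1) (false, false) (false, true) 0 =
      wordCount t m (false, true) (false, false) 0 ∧
    wordCount t (m + 1) (false, false) (false, true) 1 =
      wordCount t m (false, true) (false, false) 1 ∧
    wordCount t (m + 1) (false, false) (false, true) 2 =
      wordCount t m (true, true) (false, false) 0 +
      wordCount t m (false, true) (false, false) 2 ∧
    wordCount t (m + 1) (false, false) (true, true) 0 =
      wordCount t m (true, true) (false, false) 0 ∧
    wordCount t (m + 1) (false, false) (true, true) 1 =
      wordCount t m (true, true) (false, false) 1 ∧
    wordCount t (m + 1) (false, false) (true, true) 2 =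
      wordCount t m (true, true) (false, false) 2 := by
  refine ⟨?_, ?_, ?_, ?_, ?_, ?_, ?_, ?_, ?_, ?_, ?_, ?_, ?_, ?_, ?_, ?_, ?_, ?_, ?_, ?_, ?_⟩ <;>
    rw [wordCount_succ ht] <;>
    simp +decide [Fintype.sum_prod_type, potential, demand, Col.weight, add_assoc] <;>
    rfl

lemma wordCount_top (j : ℕ) :
    wordCount (true, false) (4 * j + 8) (true, true) (false, false) 1 = 4 * j + 10 ∧
    wordCount (true, false) (4 * j + 8) (true, false) (false, false) 1 = 2 * j + 5 ∧
    wordCount (true, false) (4 * j + 8) (false, true) (false, false) 1 = 2 * j + 5 ∧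
    wordCount (true, false) (4 * j + 8) (false, false) (false, false) 0 = 1 ∧
    wordCount (true, false) (4 * j + 8) (false, false) (false, false) 2 = 8 * j ^ 2 + 44 * j + 55 ∧
    wordCount (true, false) (4 * j + 8) (false, false) (true, false) 0 = 1 ∧
    wordCount (true, false) (4 * j + 8) (false, false) (true, false) 2 = 4 * j ^ 2 + 20 * j + 24 ∧
    wordCount (true, false) (4 * j + 8) (false, false) (false, true) 0 = 0 ∧
    wordCount (true, false) (4 * j + 8) (false, false) (false, true) 2 = 4 * j ^ 2 + 20 * j + 24 ∧
    wordCount (true, false) (4 * j + 8) (false, false) (true, true) 0 = 1 ∧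
    wordCount (true, false) (4 * j + 8) (false, false) (true, true) 2 = 8 * j ^ 2 + 40 * j + 43 := by
  have ht : ((true, false) : Col) ≠ ⊥ := by decide
  induction j with
  | zero =>
    simp +decide [wordCount_recurrences ht, wordCount_zero]
  | succ j ih =>
    rw [show 4 * (j + 1) + 8 = 4 * j + 8 + 1 + 1 + 1 + 1 by ring]
    generalize 4 * j + 8 = m at ih ⊢
    simp only [wordCount_recurrences ht, ih]
    refine ⟨?_, ?_, ?_, ?_, ?_, ?_, ?_, ?_, ?_, ?_, ?_⟩ <;> first | trivial | ring

lemma wordCount_full (j : ℕ) :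
    wordCount (true, true) (4 * j + 8) (true, true) (false, false) 1 = 0 ∧
    wordCount (true, true) (4 * j + 8) (true, false) (false, false) 1 = 0 ∧
    wordCount (true, true) (4 * j + 8) (false, true) (false, false) 1 = 0 ∧
    wordCount (true, true) (4 * j + 8) (false, false) (false, false) 0 = 0 ∧
    wordCount (true, true) (4 * j + 8) (false, false) (false, false) 2 = 2 ∧
    wordCount (true, true) (4 * j + 8) (false, false) (true, false) 0 = 0 ∧
    wordCount (true, true) (4 * j + 8) (false, false) (true, false) 2 = 1 ∧
    wordCount (true, true) (4 * j + 8) (false, false) (false, true) 0 = 0 ∧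
    wordCount (true, true) (4 * j + 8) (false, false) (false, true) 2 = 1 ∧
    wordCount (true, true) (4 * j + 8) (false, false) (true, true) 0 = 0 ∧
    wordCount (true, true) (4 * j + 8) (false, false) (true, true) 2 = 2 := by
  have ht : ((true, true) : Col) ≠ ⊥ := by decide
  induction j with
  | zero =>
    simp +decide [wordCount_recurrences ht, wordCount_zero]
  | succ j ih =>
    rw [show 4 * (j + 1) + 8 = 4 * j + 8 + 1 + 1 + 1 + 1 by ring]
    generalize 4 * j + 8 = m at ih ⊢
    simp only [wordCount_recurrences ht, ih]
    refine ⟨?_, ?_, ?_, ?_, ?_, ?_, ?_, ?_, ?_, ?_, ?_⟩ <;> trivial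

lemma accepts_iff (h : ℕ → Col) (m : ℕ) (r : Col) :
    Accepts (h (m + 1)) m (h 0) r (fun i => h (i + 1)) ↔
      r ≤ h 1 ∧ ∀ i < m, demand (h i) (h (i + 1)) ≤ h (i + 2) := by
  induction m generalizing h r with
  | zero => simp [Accepts]
  | succ m ih =>
    have key := ih (fun i => h (i + 1)) (demand (h 0) (h 1))
    rw [Accepts, Nat.forall_lt_succ_left']
    exact and_congr_right fun _ => key

lemma add_one_eq_of_ne : ∀ {a b : Fin 2}, a ≠ b → b + 1 = a := by decide

variable {m : ℕ}

/-- Selections of vertices of `P₂ □ Cₙ`, read as cyclic sequences of columns seen from `v`. -/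
def columns (v : Fin 2 × Fin (m + 1)) :
    Finset (Fin 2 × Fin (m + 1)) ≃ (Fin (m + 1) → Col) where
  toFun D x := (decide ((v.1, v.2 + x) ∈ D), decide ((v.1 + 1, v.2 + x) ∈ D))
  invFun h := {u | (if u.1 = v.1 then (h (u.2 - v.2)).1 else (h (u.2 - v.2)).2) = true}
  left_inv D := by
    ext ⟨a, x⟩
    obtain ⟨b, y⟩ := v
    simp only [mem_filter, mem_univ, true_and, add_sub_cancel]
    split_ifs with h
    · simp [h]
    · simp [add_one_eq_of_ne h]
  right_inv h := by
    funext x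
    simp

lemma card_eq_sum_weight (v : Fin 2 × Fin (m + 1)) (D : Finset (Fin 2 × Fin (m + 1))) :
    #D = ∑ x, (columns v D x).weight := by
  obtain ⟨b, y⟩ := v
  have h1 : #D = ∑ x : Fin (m + 1), ∑ a : Fin 2, if (a, x) ∈ D then 1 else 0 := by
    rw [sum_comm, ← Fintype.sum_prod_type' (f := fun a x => if (a, x) ∈ D then 1 else 0)]
    simp
  rw [h1, ← Equiv.sum_comp (Equiv.addLeft y)]
  refine sum_congr rfl fun x _ => ?_
  rw [← Equiv.sum_comp (Equiv.addLeft b)]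
  simp only [columns, Col.weight, Fin.sum_univ_two, Equiv.coe_fn_mk, Equiv.coe_addLeft, add_zero,
    Bool.toNat, Bool.cond_decide]
  congr!

lemma isDomSet_iff_demand (hm : 2 ≤ m) (v : Fin 2 × Fin (m + 1))
    (D : Finset (Fin 2 × Fin (m + 1))) :
    isDomSet (pathGraph 2 □ cycleGraph (m + 1)) D ↔
      ∀ x, demand (columns v D (x - 1)) (columns v D x) ≤ columns v D (x + 1) := by
  obtain ⟨k, rfl⟩ : ∃ k, m = k + 1 := ⟨m - 1, by omega⟩
  obtain ⟨b, y⟩ := v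
  have hdom : ∀ u : Fin 2 × Fin (k + 1 + 1),
      (u ∉ D → ∃ w ∈ D, (pathGraph 2 □ cycleGraph (k + 1 + 1)).Adj w u) ↔
        (u.1, u.2) ∈ D ∨ (u.1 + 1, u.2) ∈ D ∨ (u.1, u.2 - 1) ∈ D ∨ (u.1, u.2 + 1) ∈ D := by
    rintro ⟨a, x⟩
    simp only [boxProd_adj, pathGraph_two_eq_top, top_adj, cycleGraph_adj, Prod.exists]
    constructor
    · intro h
      by_cases hu : (a, x) ∈ D
      · exact .inl hu
      obtain ⟨a', x', hw, ⟨hne, rfl⟩ | ⟨h' | h', rfl⟩⟩ := h hu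
      · exact .inr (.inl (add_one_eq_of_ne hne ▸ hw))
      · obtain rfl : x' = x + 1 := by rw [← h']; abel
        exact .inr (.inr (.inr hw))
      · obtain rfl : x' = x - 1 := by rw [← h']; abel
        exact .inr (.inr (.inl hw))
    · rintro (h | h | h | h) hu
      · exact absurd h hu
      · exact ⟨_, _, h, .inl ⟨by simp, rfl⟩⟩
      · exact ⟨_, _, h, .inr ⟨.inr (by abel), rfl⟩⟩
      · exact ⟨_, _, h, .inr ⟨.inl (by abel), rfl⟩⟩
  have hcol : ∀ x, demand (columns (b, y) D (x - 1)) (columns (b, y) D x) ≤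
      columns (b, y) D (x + 1) ↔ ∀ a,
        (a, y + x) ∈ D ∨ (a + 1, y + x) ∈ D ∨ (a, y + x - 1) ∈ D ∨ (a, y + x + 1) ∈ D := by
    intro x
    have ha : ∀ P : Fin 2 → Prop, (∀ a, P a) ↔ P b ∧ P (b + 1) := by
      intro P
      fin_cases b <;> simp [Fin.forall_fin_two, and_comm]
    have hb : b + 1 + 1 = b := by fin_cases b <;> rfl
    rw [ha, hb]
    simp only [columns, Equiv.coe_fn_mk, ← add_sub_assoc, ← add_assoc]
    by_cases h1 : (b, y + x) ∈ D <;> by_cases h2 : (b + 1, y + x) ∈ D <;>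
      by_cases h3 : (b, y + x - 1) ∈ D <;> by_cases h4 : (b + 1, y + x - 1) ∈ D <;>
      by_cases h5 : (b, y + x + 1) ∈ D <;> by_cases h6 : (b + 1, y + x + 1) ∈ D <;>
      simp +decide [h1, h2, h3, h4, h5, h6, demand]
  rw [isDomSet, forall_congr' hdom, forall_congr' hcol]
  constructor
  · exact fun h x a => h (a, y + x)
  · rintro h ⟨a, x⟩
    simpa using h (x - y) a

lemma accepts_iff_demand (c : Col) (hc : c ≠ ⊥) (f : Fin m → Col) :
    Accepts c m c ⊥ f ↔ ∀ x : Fin (m + 1),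
      demand (Fin.cons (α := fun _ => Col) c f (x - 1)) (Fin.cons (α := fun _ => Col) c f x) ≤
        Fin.cons (α := fun _ => Col) c f (x + 1) := by
  set g : Fin (m + 1) → Col := Fin.cons c f with hg
  have key := accepts_iff (fun i => g (Fin.ofNat (m + 1) i)) m ⊥
  have h0 : g (Fin.ofNat (m + 1) 0) = c := by simp [hg]
  have h1 : g (Fin.ofNat (m + 1) (m + 1)) = c := by simp [hg, Fin.ofNat]
  have hf : (fun i : Fin m => g (Fin.ofNat (m + 1) (i + 1))) = f := by
    funext i
    have : Fin.ofNat (m + 1) (i + 1) = i.succ := by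
      ext; simp [Fin.ofNat]
    rw [this, hg, Fin.cons_succ]
  have hadd : ∀ i : ℕ, Fin.ofNat (m + 1) (i + 1) = Fin.ofNat (m + 1) i + 1 := by
    intro i
    ext
    simp [Fin.ofNat, Fin.val_add]
  simp only [h1, h0, hf, bot_le, true_and] at key
  have hg0 : g 0 = c := by simp [hg]
  rw [key, Fin.forall_fin_succ, hg0, demand, if_neg hc, and_iff_right bot_le, Fin.forall_iff]
  refine forall₂_congr fun i hi => ?_
  have hs : (Fin.succ ⟨i, hi⟩ : Fin (m + 1)) = Fin.ofNat (m + 1) i + 1 := by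
    rw [← hadd]
    ext
    simpa [Fin.ofNat] using (Nat.mod_eq_of_lt (by omega : i + 1 < m + 1)).symm
  rw [hs, add_sub_cancel_right, ← hadd, ← hadd]

/-- The number of dominating sets of size `k` containing `v`. -/
noncomputable def domCount (v : Fin 2 × Fin (m + 1)) (k : ℕ) : ℕ :=
  #{D | isDomSet (pathGraph 2 □ cycleGraph (m + 1)) D ∧ v ∈ D ∧ #D = k}

lemma domCount_eq_sum (hm : 2 ≤ m) (v : Fin 2 × Fin (m + 1)) (k : ℕ) :
    domCount v k =
      #{f : Fin m → Col | Accepts (true, true) m (true, true) ⊥ f ∧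
        2 + ∑ i, (f i).weight = k} +
      #{f : Fin m → Col | Accepts (true, false) m (true, false) ⊥ f ∧
        1 + ∑ i, (f i).weight = k} := by
  have h1 : domCount v k = #{h : Fin (m + 1) → Col |
      (∀ x, demand (h (x - 1)) (h x) ≤ h (x + 1)) ∧ (h 0).1 = true ∧
        ∑ x, (h x).weight = k} := by
    refine card_equiv (columns v) fun D => ?_
    simp only [mem_filter, mem_univ, true_and, isDomSet_iff_demand hm v, ← card_eq_sum_weight]
    simp [columns]
  rw [h1, card_filter_cons, Fintype.sum_prod_type]
  simp only [Fintype.sum_bool, Fin.cons_zero, Fin.sum_univ_succ, Fin.cons_succ,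
    ← accepts_iff_demand (true, true) (by decide), ← accepts_iff_demand (true, false) (by decide)]
  simp [Col.weight]
  congr!

lemma domCount_eq_zero (hm : 2 ≤ m) (v : Fin 2 × Fin (m + 1)) {k : ℕ} (hk : 2 * k < m + 1) :
    domCount v k = 0 := by
  rw [domCount_eq_sum hm, Nat.add_eq_zero_iff]
  constructor <;>
  · refine card_eq_zero.2 (filter_eq_empty_iff.2 ?_)
    rintro f - ⟨hf, hw⟩
    have := hf.le_weight (by decide)
    simp +decide only [offset, potential, if_true, if_false] at this
    omega

lemma domCount_eq (hm : 2 ≤ m) (v : Fin 2 × Fin (m + 1)) {k e : ℕ} (hk : 2 * k = m + 1 + e) :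
    domCount v k = wordCount (true, true) m (true, true) (false, false) e +
      wordCount (true, false) m (true, false) (false, false) e := by
  rw [domCount_eq_sum hm, wordCount, wordCount]
  congr 1 <;>
  · refine congrArg card (filter_congr fun f _ => and_congr_right fun _ => ?_)
    simp +decide only [offset, potential, if_true, if_false]
    omega

lemma DV_eq_domCount {g c : ℕ} (hc : c ≠ 0)
    (hlt : ∀ (u : Fin 2 × Fin (m + 1)), ∀ k < g, domCount u k = 0)
    (hg : ∀ u : Fin 2 × Fin (m + 1), domCount u g = c) (v : Fin 2 × Fin (m + 1)) :
    DV (pathGraph 2 □ cycleGraph (m + 1)) v = c := by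
  have hnum : domNum (pathGraph 2 □ cycleGraph (m + 1)) = g := by
    refine IsLeast.csInf_eq ⟨?_, ?_⟩
    · obtain ⟨D, hD⟩ := card_pos.1 (Nat.pos_of_ne_zero (hg v ▸ hc))
      simp only [mem_filter, mem_univ, true_and] at hD
      exact ⟨D, hD.1, hD.2.2⟩
    · rintro _ ⟨D, hD, rfl⟩
      obtain ⟨u, hu⟩ : D.Nonempty := by
        by_cases hv : v ∈ D
        · exact ⟨v, hv⟩
        · exact (hD v hv).imp fun _ h => h.1
      by_contra! hlt'
      have := hlt u _ hlt'
      rw [domCount, card_eq_zero, filter_eq_empty_iff] at this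
      exact this (mem_univ D) ⟨hD, hu, rfl⟩
  rw [← hg v, DV, gammaSets, hnum, filter_filter, domCount]
  congr 1
  ext D
  simp only [mem_filter, mem_univ, true_and]
  tauto

/-- Domination value from the counts at the least excess `e`, a value determined by parity. -/
lemma DV_eq_wordCount (hm : 2 ≤ m) {g e c : ℕ} (hg : 2 * g = m + 1 + e) (he : e ≤ 2)
    (hzero : e = 2 → wordCount (true, true) m (true, true) (false, false) 0 +
      wordCount (true, false) m (true, false) (false, false) 0 = 0)
    (hval : wordCount (true, true) m (true, true) (false, false) e +
      wordCount (true, false) m (true, false) (false, false) e = c)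
    (hc : c ≠ 0) (v : Fin 2 × Fin (m + 1)) :
    DV (pathGraph 2 □ cycleGraph (m + 1)) v = c := by
  refine DV_eq_domCount hc (g := g) (fun u k hk => ?_) (fun u => by rw [domCount_eq hm u hg, hval]) v
  by_cases hk' : 2 * k < m + 1
  · exact domCount_eq_zero hm u hk'
  · rw [domCount_eq hm u (e := 0) (by omega), hzero (by omega)]

theorem DV_P2_boxProd_Cn (n : ℕ) (hn : 3 ≤ n) (v : Fin 2 × Fin n) :
    DV (pathGraph 2 □ cycleGraph n) v =
      if n = 3 then 3
      else if n = 6 then 17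
      else if n % 4 = 0 then 1
      else if n % 4 = 2 then ((n + 2) / 2) ^ 2
      else (n + 1) / 2 := by
  obtain ⟨m, rfl⟩ : ∃ m, n = m + 1 := ⟨n - 1, by omega⟩
  have hm : 2 ≤ m := by omega
  have htop : ((true, false) : Col) ≠ ⊥ := by decide
  have hfull : ((true, true) : Col) ≠ ⊥ := by decide
  rcases lt_or_ge m 8 with h8 | h8
  · interval_cases m
    · refine DV_eq_wordCount hm (g := 2) (e := 1) ?_ ?_ ?_ ?_ ?_ v <;>
        simp +decide [wordCount_recurrences htop, wordCount_recurrences hfull, wordCount_zero]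
    · refine DV_eq_wordCount hm (g := 2) (e := 0) ?_ ?_ ?_ ?_ ?_ v <;>
        simp +decide [wordCount_recurrences htop, wordCount_recurrences hfull, wordCount_zero]
    · refine DV_eq_wordCount hm (g := 3) (e := 1) ?_ ?_ ?_ ?_ ?_ v <;>
        simp +decide [wordCount_recurrences htop, wordCount_recurrences hfull, wordCount_zero]
    · refine DV_eq_wordCount hm (g := 4) (e := 2) ?_ ?_ ?_ ?_ ?_ v <;>
        simp +decide [wordCount_recurrences htop, wordCount_recurrences hfull, wordCount_zero]
    · refine DV_eq_wordCount hm (g := 4) (e := 1) ?_ ?_ ?_ ?_ ?_ v <;>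
        simp +decide [wordCount_recurrences htop, wordCount_recurrences hfull, wordCount_zero]
    · refine DV_eq_wordCount hm (g := 4) (e := 0) ?_ ?_ ?_ ?_ ?_ v <;>
        simp +decide [wordCount_recurrences htop, wordCount_recurrences hfull, wordCount_zero]
  obtain ⟨j, r, hr, rfl⟩ : ∃ j r, r < 4 ∧ m = 4 * j + 8 + r :=
    ⟨(m - 8) / 4, m % 4, by omega, by omega⟩
  have ht := wordCount_top j
  have hf := wordCount_full j
  rw [if_neg (by omega), if_neg (by omega)]
  have hmod : (4 * j + 8 + r + 1) % 4 = (r + 1) % 4 := by omega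
  rw [hmod]
  interval_cases r
  · refine DV_eq_wordCount hm (g := 2 * j + 5) (e := 1) (by omega) (by omega)
      (by omega) ?_ (by simp) v
    simp only [ht, hf, add_zero]
    norm_num
    omega
  · have h2 : (4 * j + 8 + 1 + 1 + 2) / 2 = 2 * j + 6 := by omega
    refine DV_eq_wordCount hm (g := 2 * j + 6) (e := 2) (by omega) (by omega)
      (fun _ => ?_) ?_ ?_ v
    · generalize 4 * j + 8 = m at ht hf ⊢
      simp only [wordCount_recurrences htop, wordCount_recurrences hfull, ht, hf]
    · rw [h2]
      generalize 4 * j + 8 = m at ht hf ⊢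
      simp only [wordCount_recurrences htop, wordCount_recurrences hfull, ht, hf]
      norm_num
      ring
    · simp
  · refine DV_eq_wordCount hm (g := 2 * j + 6) (e := 1) (by omega) (by omega)
      (by omega) ?_ (by simp) v
    have h2 : (4 * j + 8 + 2 + 1 + 1) / 2 = 2 * j + 6 := by omega
    rw [h2]
    generalize 4 * j + 8 = m at ht hf ⊢
    simp only [wordCount_recurrences htop, wordCount_recurrences hfull, ht, hf]
    norm_num
    ring
  · refine DV_eq_wordCount hm (g := 2 * j + 6) (e := 0) (by omega) (by omega)
      (by omega) ?_ (by simp) v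
    generalize 4 * j + 8 = m at ht hf ⊢
    simp only [wordCount_recurrences htop, wordCount_recurrences hfull, ht, hf]
    norm_num
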